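/- arXiv:2003.11918 — 7 statements merged into one kernel-verified Lean document; each statement's English description precedes it below -/
import Mathlib

section
/- Let d ≥ 1, let U ⊆ ℝ^d be a compact set, and let f : ℝ^d → ℝ^d be a C¹ map that is injective on U and maps U into the interior of U. Then for every real r > 0, for Lebesgue-almost every x ∈ U there exists N ≥ 1 such that |det D(f^n)(x)| ≤ e^{n·r} for all n ≥ N. -/
open MeasureTheory Filter Topology Set

theorem contDiff_iterate {𝕜 E : Type*} [NontriviallyNormedField 𝕜] [NormedAddCommGroup E]
    [NormedSpace 𝕜 E] {k : WithTop ℕ∞} {f : E → E} (hf : ContDiff 𝕜 k f) (n : ℕ) :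
    ContDiff 𝕜 k f^[n] := by
  induction n with
  | zero => exact contDiff_id
  | succ n ih => exact ih.comp hf

/-- Chebyshev's inequality for the Jacobian of a `C¹` map that sends `U` injectively into itself. -/
theorem measure_le_abs_det_fderiv_le {E : Type*} [NormedAddCommGroup E] [NormedSpace ℝ E]
    [FiniteDimensional ℝ E] [MeasurableSpace E] [BorelSpace E] (μ : Measure E)
    [μ.IsAddHaarMeasure] {U : Set E} (hU : MeasurableSet U) {g : E → E} (hg : ContDiff ℝ 1 g)
    (hinj : InjOn g U) (hmaps : MapsTo g U U) (t : ℝ) :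
    μ.restrict U {x | Real.exp t ≤ |(fderiv ℝ g x).det|} ≤
      ENNReal.ofReal (Real.exp (-t)) * μ U := by
  have hmeas : Measurable fun x => ENNReal.ofReal |(fderiv ℝ g x).det| :=
    (ENNReal.continuous_ofReal.comp (continuous_abs.comp
      (ContinuousLinearMap.continuous_det.comp (hg.continuous_fderiv one_ne_zero)))).measurable
  have hint : ∫⁻ x in U, ENNReal.ofReal |(fderiv ℝ g x).det| ∂μ ≤ μ U :=
    (lintegral_abs_det_fderiv_le_addHaar_image μ hU
      (fun x _ => (hg.differentiable one_ne_zero x).hasFDerivAt.hasFDerivWithinAt) hinj).trans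
      (measure_mono hmaps.image_subset)
  have hcheb := (mul_meas_ge_le_lintegral (μ := μ.restrict U) hmeas
    (ENNReal.ofReal (Real.exp t))).trans hint
  simp only [ENNReal.ofReal_le_ofReal_iff (abs_nonneg _)] at hcheb
  calc μ.restrict U {x | Real.exp t ≤ |(fderiv ℝ g x).det|}
      = ENNReal.ofReal (Real.exp (-t)) * (ENNReal.ofReal (Real.exp t) *
          μ.restrict U {x | Real.exp t ≤ |(fderiv ℝ g x).det|}) := by
        rw [← mul_assoc, ← ENNReal.ofReal_mul (Real.exp_pos _).le, ← Real.exp_add]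
        simp
    _ ≤ ENNReal.ofReal (Real.exp (-t)) * μ U := by gcongr

theorem borel_cantelli_jacobian
    (d : ℕ) (hd : 1 ≤ d) (U : Set (EuclideanSpace ℝ (Fin d))) (hU : IsCompact U)
    (f : EuclideanSpace ℝ (Fin d) → EuclideanSpace ℝ (Fin d))
    (hf : ContDiff ℝ 1 f) (hinj : Set.InjOn f U)
    (hmaps : Set.MapsTo f U (interior U))
    (r : ℝ) (hr : 0 < r) :
    ∀ᵐ x ∂(volume.restrict U), ∃ N : ℕ, 1 ≤ N ∧
      ∀ n : ℕ, N ≤ n → |(fderiv ℝ (f^[n]) x).det| ≤ Real.exp (n * r) := by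
  have hself : MapsTo f U U := hmaps.mono_right interior_subset
  have hbound (n : ℕ) :
      volume.restrict U {x | Real.exp (n * r) ≤ |(fderiv ℝ (f^[n]) x).det|} ≤
        ENNReal.ofReal (Real.exp (-r)) ^ n * volume U := by
    have h := measure_le_abs_det_fderiv_le volume hU.measurableSet (contDiff_iterate hf n)
      (hinj.iterate hself n) (hself.iterate n) (n * r)
    rwa [← mul_neg, Real.exp_nat_mul (-r), ENNReal.ofReal_pow (Real.exp_pos _).le] at h
  have hsum : ∑' n : ℕ,
      volume.restrict U {x | Real.exp (n * r) ≤ |(fderiv ℝ (f^[n]) x).det|} ≠ ⊤ := by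
    refine ne_top_of_le_ne_top ?_ (ENNReal.tsum_le_tsum hbound)
    rw [ENNReal.tsum_mul_right, ENNReal.tsum_geometric]
    refine ENNReal.mul_ne_top (ENNReal.inv_ne_top.2 (tsub_pos_of_lt ?_).ne') hU.measure_lt_top.ne
    simpa using hr
  filter_upwards [ae_eventually_notMem hsum] with x hx
  obtain ⟨N, hN⟩ := eventually_atTop.1 hx
  exact ⟨max N 1, le_max_right _ _, fun n hn =>
    (not_le.1 (hN n ((le_max_left _ _).trans hn))).le⟩
end

section
/- Let X be a compact metric space and f : X → X a continuous map, and set Λ_f = ⋂_{n≥0} f^n(X). Then the attracting set depends upper semi-continuously on the map: for every open set V ⊇ Λ_f there exists δ > 0 such that for every continuous map g : X → X with sup_{x∈X} dist(f(x), g(x)) < δ, one has Λ_g = ⋂_{n≥0} g^n(X) ⊆ V. -/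
open Filter Topology Set

/-- The iterates of a uniformly continuous map depend continuously on the map, uniformly in the
point. -/
theorem UniformContinuous.exists_forall_dist_iterate_lt {X : Type*} [PseudoMetricSpace X]
    {f : X → X} (hf : UniformContinuous f) (n : ℕ) {ε : ℝ} (hε : 0 < ε) :
    ∃ δ > (0 : ℝ), ∀ g : X → X, (∀ x, dist (f x) (g x) < δ) →
      ∀ x, dist (f^[n] x) (g^[n] x) < ε := by
  induction n generalizing ε with
  | zero => exact ⟨1, one_pos, fun g _ x => by simpa using hε⟩
  | succ n ih =>
    obtain ⟨η, hη, hfη⟩ := Metric.uniformContinuous_iff.1 hf (ε / 2) (half_pos hε)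
    obtain ⟨δ, hδ, hn⟩ := ih hη
    refine ⟨min δ (ε / 2), lt_min hδ (half_pos hε), fun g hg x => ?_⟩
    rw [Function.iterate_succ_apply', Function.iterate_succ_apply']
    have h₁ := hfη (hn g (fun y => (hg y).trans_le (min_le_left _ _)) x)
    have h₂ := (hg (g^[n] x)).trans_le (min_le_right _ _)
    linarith [dist_triangle (f (f^[n] x)) (f (g^[n] x)) (g (g^[n] x))]

theorem Function.antitone_range_iterate {X : Type*} (f : X → X) :
    Antitone fun n : ℕ => Set.range f^[n] :=
  antitone_nat_of_succ_le fun n => by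
    rw [Function.iterate_succ]
    exact Set.range_comp_subset_range _ _

theorem attracting_set_upper_semicontinuous
    {X : Type*} [MetricSpace X] [CompactSpace X]
    (f : X → X) (hf : Continuous f)
    (V : Set X) (hV : IsOpen V)
    (hΛf : (⋂ n : ℕ, Set.range f^[n]) ⊆ V) :
    ∃ δ > (0 : ℝ), ∀ g : X → X, Continuous g →
      (∀ x : X, dist (f x) (g x) < δ) →
      (⋂ n : ℕ, Set.range g^[n]) ⊆ V := by
  have hcompact (n : ℕ) : IsCompact (Set.range f^[n]) := isCompact_range (hf.iterate n)
  obtain ⟨n, hn⟩ := exists_subset_nhds_of_isCompact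
    (Function.antitone_range_iterate f).directed_ge hcompact
    fun x hx => hV.mem_nhds (hΛf hx)
  obtain ⟨ε, hε, hεV⟩ := (hcompact n).exists_thickening_subset_open hV hn
  obtain ⟨δ, hδ, hfg⟩ :=
    (CompactSpace.uniformContinuous_of_continuous hf).exists_forall_dist_iterate_lt n hε
  refine ⟨δ, hδ, fun g _ hg y hy => ?_⟩
  obtain ⟨x, rfl⟩ := Set.mem_iInter.1 hy n
  exact hεV (Metric.mem_thickening_iff.2
    ⟨f^[n] x, Set.mem_range_self x, by simpa only [dist_comm] using hfg g hg x⟩)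
end

section
/- Fix reals k ≥ 3, a ∈ (0,1), K > 0, and set c = 2K/(k(1−a)). Let E be a real normed vector space and let L : ℝ × E → ℝ × E be a solenoid-model linear map, i.e. L(u,v) = (k·u, u·b + A v) where b ∈ E satisfies ‖b‖ ≤ K and A : E → E is linear with (1/(a·k))·‖v‖ ≤ ‖A v‖ ≤ a·k·‖v‖ for all v ∈ E. Then the unstable cone C^u = {(u,v) : ‖v‖ ≤ c·|u|} is forward invariant: if ‖v‖ ≤ c·|u| then ‖u·b + A v‖ ≤ c·k·|u|, i.e. L(u,v) ∈ C^u. -/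
theorem unstable_cone_invariance
    {E : Type*} [NormedAddCommGroup E] [NormedSpace ℝ E]
    (k a K c : ℝ) (hk : 3 ≤ k) (ha0 : 0 < a) (ha1 : a < 1) (hK : 0 < K)
    (hc : c = 2 * K / (k * (1 - a)))
    (b : E) (hb : ‖b‖ ≤ K)
    (A : E →ₗ[ℝ] E)
    (hA : ∀ v : E, (1 / (a * k)) * ‖v‖ ≤ ‖A v‖ ∧ ‖A v‖ ≤ a * k * ‖v‖)
    (u : ℝ) (v : E) (huv : ‖v‖ ≤ c * |u|) :
    ‖u • b + A v‖ ≤ c * k * |u| := by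
  have hk0 : 0 < k := by linarith
  have hcK : c * (k * (1 - a)) = 2 * K := by
    rw [hc]
    exact div_mul_cancel₀ _ (mul_pos hk0 (sub_pos.mpr ha1)).ne'
  calc ‖u • b + A v‖ ≤ |u| * ‖b‖ + ‖A v‖ := by
        simpa [norm_smul] using norm_add_le (u • b) (A v)
    _ ≤ |u| * K + a * k * (c * |u|) := by
        gcongr
        exact (hA v).2.trans (by gcongr)
    _ ≤ |u| * (2 * K) + a * k * (c * |u|) := by
        gcongr
        linarith
    _ = c * k * |u| := by
        rw [← hcK]
        ring
end

section
/- Fix reals k ≥ 3, a ∈ (0,1), K > 0, and set c = 2K/(k(1−a)). Let E be a real normed vector space and let L_1, …, L_N (N ≥ 1) each be a solenoid-model linear map on ℝ × E, i.e. L_i(u,v) = (k·u, u·b_i + A_i v) with ‖b_i‖ ≤ K and (1/(a·k))·‖v‖ ≤ ‖A_i v‖ ≤ a·k·‖v‖ for all v. Let T = L_N ∘ ⋯ ∘ L_1. Then for every (s,p) ∈ ℝ × E with ‖p‖ ≤ c·|s|, the image T(s,p) has first component k^N·s and second component p' satisfying ‖p'‖ ≤ c·k^N·|s|. -/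
/-- The cone `‖v‖ ≤ c * |u|` is invariant under `(u, v) ↦ (k * u, u • b + A v)` as soon as
`K + r * c ≤ c * k`, where `‖b‖ ≤ K` and `r` bounds the expansion of `A`. -/
theorem norm_smul_add_le_of_mem_cone
    {E : Type*} [NormedAddCommGroup E] [NormedSpace ℝ E] {k r K c u : ℝ} {b v : E} {A : E → E}
    (hr : 0 ≤ r) (hc : K + r * c ≤ c * k) (hb : ‖b‖ ≤ K)
    (hA : ‖A v‖ ≤ r * ‖v‖) (hv : ‖v‖ ≤ c * |u|) :
    ‖u • b + A v‖ ≤ c * (k * |u|) :=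
  calc ‖u • b + A v‖ ≤ |u| * ‖b‖ + ‖A v‖ := by
        simpa [norm_smul] using norm_add_le (u • b) (A v)
    _ ≤ |u| * K + r * (c * |u|) := by
        gcongr
        exact hA.trans (by gcongr)
    _ = (K + r * c) * |u| := by ring
    _ ≤ c * k * |u| := by gcongr
    _ = c * (k * |u|) := by ring

theorem unstable_cone_invariance_iterated
    {E : Type*} [NormedAddCommGroup E] [NormedSpace ℝ E]
    (k a K c : ℝ) (hk : 3 ≤ k) (ha0 : 0 < a) (ha1 : a < 1) (hK : 0 < K)
    (hc : c = 2 * K / (k * (1 - a)))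
    (N : ℕ) (hN : 1 ≤ N)
    (b : ℕ → E) (A : ℕ → E →ₗ[ℝ] E)
    (hb : ∀ i < N, ‖b i‖ ≤ K)
    (hA : ∀ i < N, ∀ v : E, (1 / (a * k)) * ‖v‖ ≤ ‖A i v‖ ∧ ‖A i v‖ ≤ a * k * ‖v‖)
    (s : ℝ) (p : E) (hp : ‖p‖ ≤ c * |s|)
    (w : ℕ → ℝ × E) (hw0 : w 0 = (s, p))
    (hwstep : ∀ i < N, w (i + 1) = (k * (w i).1, (w i).1 • b i + A i (w i).2)) :
    (w N).1 = k ^ N * s ∧ ‖(w N).2‖ ≤ c * (k ^ N * |s|) := by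
  have hk0 : 0 < k := by linarith
  have hcone : K + a * k * c ≤ c * k := by
    have h : c * (k * (1 - a)) = 2 * K := by
      rw [hc]
      exact div_mul_cancel₀ _ (mul_pos hk0 (sub_pos.2 ha1)).ne'
    linarith
  suffices h : ∀ n ≤ N, (w n).1 = k ^ n * s ∧ ‖(w n).2‖ ≤ c * (k ^ n * |s|) from h N le_rfl
  intro n
  induction n with
  | zero => simpa [hw0] using hp
  | succ n ih =>
    intro hn
    obtain ⟨h1, h2⟩ := ih (by omega)
    have habs : |(w n).1| = k ^ n * |s| := by
      rw [h1, abs_mul, abs_of_pos (pow_pos hk0 n)]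
    rw [hwstep n hn, pow_succ', mul_assoc, mul_assoc, ← h1, ← habs]
    exact ⟨rfl, norm_smul_add_le_of_mem_cone (by positivity) hcone (hb n hn)
      (hA n hn _).2 (habs ▸ h2)⟩
end

section
/- Fix reals k ≥ 3, a ∈ (0,1), K > 0, and set c' = 3K/(k(1−a)). Let E be a real normed vector space and let L : ℝ × E → ℝ × E be a solenoid-model linear map, i.e. L(u,v) = (k·u, u·b + A v) with ‖b‖ ≤ K and (1/(a·k))·‖v‖ ≤ ‖A v‖ ≤ a·k·‖v‖ for all v ∈ E. Then the center-stable cone C^cs = {(u,v) : ‖v‖ ≥ c'·|u|} is backward invariant: if the image satisfies ‖u·b + A v‖ ≥ c'·k·|u| (i.e. L(u,v) ∈ C^cs), then ‖v‖ ≥ c'·|u| (i.e. (u,v) ∈ C^cs). -/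
theorem center_stable_cone_backward_invariance
    {E : Type*} [NormedAddCommGroup E] [NormedSpace ℝ E]
    (k a K c' : ℝ) (hk : 3 ≤ k) (ha0 : 0 < a) (ha1 : a < 1) (hK : 0 < K)
    (hc' : c' = 3 * K / (k * (1 - a)))
    (b : E) (hb : ‖b‖ ≤ K)
    (A : E →ₗ[ℝ] E)
    (hA : ∀ v : E, (1 / (a * k)) * ‖v‖ ≤ ‖A v‖ ∧ ‖A v‖ ≤ a * k * ‖v‖)
    (u : ℝ) (v : E) (huv : c' * k * |u| ≤ ‖u • b + A v‖) :
    c' * |u| ≤ ‖v‖ := by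
  have hk0 : 0 < k := by linarith
  have hcone : c' * k * (1 - a) = 3 * K := by
    have h1a : 1 - a ≠ 0 := by linarith
    rw [hc']
    field_simp
  have hub : ‖u • b‖ ≤ K * |u| := by
    rw [norm_smul, Real.norm_eq_abs, mul_comm]
    gcongr
  have hupper : c' * k * |u| ≤ K * |u| + a * k * ‖v‖ :=
    huv.trans ((norm_add_le _ _).trans (add_le_add hub (hA v).2))
  have hconeu : c' * k * |u| - a * (c' * k * |u|) = 3 * (K * |u|) := by
    linear_combination |u| * hcone
  have hKu : 0 ≤ K * |u| := by positivity
  refine le_of_mul_le_mul_left ?_ (mul_pos ha0 hk0)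
  linarith
end

section
/- Fix reals k ≥ 3, a ∈ (0,1), K > 0, and set c = 2K/(k(1−a)). Let E be a real inner product space and equip ℝ × E with the Euclidean product norm ‖(u,v)‖ = √(u² + ‖v‖²). Let L : ℝ × E → ℝ × E be a solenoid-model linear map, i.e. L(u,v) = (k·u, u·b + A v) with ‖b‖ ≤ K and (1/(a·k))·‖v‖ ≤ ‖A v‖ ≤ a·k·‖v‖ for all v ∈ E. Then every vector (u,v) in the unstable cone C^u = {(u,v) : ‖v‖ ≤ c·|u|} satisfies ‖L(u,v)‖ ≥ (k/√(1+c²))·‖(u,v)‖. In particular, if k² > 1 + c², then every nonzero vector of C^u is strictly expanded by L. -/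
/-- A pair in the cone of slope `c` around the horizontal has squared length at most
`(1 + c ^ 2) * u ^ 2`. -/
theorem sq_add_sq_le_of_le_mul_abs {u c r : ℝ} (hr : 0 ≤ r) (h : r ≤ c * |u|) :
    u ^ 2 + r ^ 2 ≤ (1 + c ^ 2) * u ^ 2 := by
  have h2 : r ^ 2 ≤ (c * |u|) ^ 2 := pow_le_pow_left₀ hr h 2
  rw [mul_pow, sq_abs] at h2
  linarith

theorem unstable_cone_expansion
    {E : Type*} [NormedAddCommGroup E] [InnerProductSpace ℝ E]
    (k a K c : ℝ) (hk : 3 ≤ k) (ha0 : 0 < a) (ha1 : a < 1) (hK : 0 < K)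
    (hc : c = 2 * K / (k * (1 - a)))
    (b : E) (hb : ‖b‖ ≤ K)
    (A : E →ₗ[ℝ] E)
    (hA : ∀ v : E, (1 / (a * k)) * ‖v‖ ≤ ‖A v‖ ∧ ‖A v‖ ≤ a * k * ‖v‖)
    (u : ℝ) (v : E) (huv : ‖v‖ ≤ c * |u|) :
    (k / Real.sqrt (1 + c ^ 2)) * Real.sqrt (u ^ 2 + ‖v‖ ^ 2)
      ≤ Real.sqrt ((k * u) ^ 2 + ‖u • b + A v‖ ^ 2) ∧
    (1 + c ^ 2 < k ^ 2 → (u, v) ≠ (0, (0 : E)) →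
      Real.sqrt (u ^ 2 + ‖v‖ ^ 2)
        < Real.sqrt ((k * u) ^ 2 + ‖u • b + A v‖ ^ 2)) := by
  have hcone := sq_add_sq_le_of_le_mul_abs (norm_nonneg v) huv
  have hpos : 0 < 1 + c ^ 2 := by positivity
  constructor
  · apply Real.le_sqrt_of_sq_le
    rw [mul_pow, div_pow, Real.sq_sqrt hpos.le, Real.sq_sqrt (by positivity)]
    calc k ^ 2 / (1 + c ^ 2) * (u ^ 2 + ‖v‖ ^ 2)
        ≤ k ^ 2 / (1 + c ^ 2) * ((1 + c ^ 2) * u ^ 2) := by gcongr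
      _ = (k * u) ^ 2 := by field_simp
      _ ≤ (k * u) ^ 2 + ‖u • b + A v‖ ^ 2 := le_add_of_nonneg_right (by positivity)
  · intro hkc hne
    have hu : u ≠ 0 := by
      rintro rfl
      exact hne (by simpa using huv)
    apply Real.sqrt_lt_sqrt (by positivity)
    calc u ^ 2 + ‖v‖ ^ 2 ≤ (1 + c ^ 2) * u ^ 2 := hcone
      _ < k ^ 2 * u ^ 2 := by gcongr
      _ = (k * u) ^ 2 := by ring
      _ ≤ (k * u) ^ 2 + ‖u • b + A v‖ ^ 2 := le_add_of_nonneg_right (by positivity)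
end

section
/- Fix reals k ≥ 3, a ∈ (0,1), K > 0, and set c = 2K/(k(1−a)). Identify ℝ × ℝ² with ℝ³ and let × denote the cross product on ℝ³. Let L_1, …, L_N (N ≥ 1) each be a solenoid-model linear map on ℝ × ℝ², i.e. L_i(u,v) = (k·u, u·b_i + A_i v) with b_i ∈ ℝ², ‖b_i‖ ≤ K, and A_i : ℝ² → ℝ² linear with (1/(a·k))·‖v‖ ≤ ‖A_i v‖ ≤ a·k·‖v‖ for all v ∈ ℝ². Let T = L_N ∘ ⋯ ∘ L_1. Then for every w₁ = (s, p) with ‖p‖ ≤ c·|s| and every w₂ = (0, q), one has ‖T(w₁) × T(w₂)‖ ≥ (a^{−N}/√(1+c²))·‖w₁ × w₂‖. In particular, if a^N·√(1+c²) < 1 and w₁ × w₂ ≠ 0, then ‖T(w₁) × T(w₂)‖ > ‖w₁ × w₂‖. -/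
/-- The vector in `ℝ³` (as a plain function `Fin 3 → ℝ`) corresponding to an
element of `ℝ × ℝ²` under the identification `ℝ × ℝ² ≅ ℝ³`. -/
noncomputable def toVec3 (w : ℝ × EuclideanSpace ℝ (Fin 2)) : Fin 3 → ℝ :=
  ![w.1, w.2 0, w.2 1]

/-- The cross product of two elements of `ℝ × ℝ²` under the identification
`ℝ × ℝ² ≅ ℝ³`, as a plain function `Fin 3 → ℝ`. -/
noncomputable def cross3 (w₁ w₂ : ℝ × EuclideanSpace ℝ (Fin 2)) : Fin 3 → ℝ :=
  crossProduct (toVec3 w₁) (toVec3 w₂)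

/-- The Euclidean norm of the cross product of two elements of `ℝ × ℝ²`. -/
noncomputable def crossNorm (w₁ w₂ : ℝ × EuclideanSpace ℝ (Fin 2)) : ℝ :=
  ‖(WithLp.equiv 2 (Fin 3 → ℝ)).symm (cross3 w₁ w₂)‖

theorem crossNorm_nonneg (w₁ w₂ : ℝ × EuclideanSpace ℝ (Fin 2)) : 0 ≤ crossNorm w₁ w₂ :=
  norm_nonneg _

theorem crossNorm_sq_vertical (s : ℝ) (p q : EuclideanSpace ℝ (Fin 2)) :
    crossNorm (s, p) (0, q) ^ 2 = (p 0 * q 1 - p 1 * q 0) ^ 2 + s ^ 2 * ‖q‖ ^ 2 := by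
  rw [crossNorm, EuclideanSpace.norm_sq_eq, EuclideanSpace.norm_sq_eq]
  simp [Fin.sum_univ_three, cross3, toVec3, cross_apply]
  ring

theorem le_crossNorm_vertical (s : ℝ) (p q : EuclideanSpace ℝ (Fin 2)) :
    |s| * ‖q‖ ≤ crossNorm (s, p) (0, q) := by
  refine (sq_le_sq₀ (by positivity) (crossNorm_nonneg _ _)).1 ?_
  rw [crossNorm_sq_vertical, mul_pow, sq_abs]
  nlinarith [sq_nonneg (p 0 * q 1 - p 1 * q 0)]

theorem crossNorm_vertical_le {s c : ℝ} {p : EuclideanSpace ℝ (Fin 2)}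
    (hp : ‖p‖ ≤ c * |s|) (q : EuclideanSpace ℝ (Fin 2)) :
    crossNorm (s, p) (0, q) ≤ √(1 + c ^ 2) * (|s| * ‖q‖) := by
  refine (sq_le_sq₀ (crossNorm_nonneg _ _) (by positivity)).1 ?_
  have hdet : (p 0 * q 1 - p 1 * q 0) ^ 2 ≤ ‖p‖ ^ 2 * ‖q‖ ^ 2 := by
    simp only [EuclideanSpace.norm_sq_eq, Fin.sum_univ_two, Real.norm_eq_abs, sq_abs]
    nlinarith [sq_nonneg (p 0 * q 0 + p 1 * q 1)]
  have hp2 : ‖p‖ ^ 2 ≤ c ^ 2 * s ^ 2 := by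
    simpa [mul_pow] using pow_le_pow_left₀ (norm_nonneg p) hp 2
  rw [crossNorm_sq_vertical, mul_pow, mul_pow, Real.sq_sqrt (by positivity), sq_abs]
  nlinarith [mul_le_mul_of_nonneg_right hp2 (sq_nonneg ‖q‖)]

theorem solenoid_area_expansion
    (k a K c : ℝ) (hk : 3 ≤ k) (ha0 : 0 < a) (ha1 : a < 1) (hK : 0 < K)
    (hc : c = 2 * K / (k * (1 - a)))
    (N : ℕ) (hN : 1 ≤ N)
    (b : ℕ → EuclideanSpace ℝ (Fin 2))
    (A : ℕ → EuclideanSpace ℝ (Fin 2) →ₗ[ℝ] EuclideanSpace ℝ (Fin 2))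
    (hb : ∀ i < N, ‖b i‖ ≤ K)
    (hA : ∀ i < N, ∀ v : EuclideanSpace ℝ (Fin 2),
      (1 / (a * k)) * ‖v‖ ≤ ‖A i v‖ ∧ ‖A i v‖ ≤ a * k * ‖v‖)
    (s : ℝ) (p q : EuclideanSpace ℝ (Fin 2)) (hp : ‖p‖ ≤ c * |s|)
    (w₁ w₂ : ℕ → ℝ × EuclideanSpace ℝ (Fin 2))
    (hw₁0 : w₁ 0 = (s, p)) (hw₂0 : w₂ 0 = (0, q))
    (hstep₁ : ∀ i < N, w₁ (i + 1) = (k * (w₁ i).1, (w₁ i).1 • b i + A i (w₁ i).2))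
    (hstep₂ : ∀ i < N, w₂ (i + 1) = (k * (w₂ i).1, (w₂ i).1 • b i + A i (w₂ i).2)) :
    (a ^ N)⁻¹ / Real.sqrt (1 + c ^ 2) * crossNorm (w₁ 0) (w₂ 0)
      ≤ crossNorm (w₁ N) (w₂ N) ∧
    (a ^ N * Real.sqrt (1 + c ^ 2) < 1 → cross3 (w₁ 0) (w₂ 0) ≠ 0 →
      crossNorm (w₁ 0) (w₂ 0) < crossNorm (w₁ N) (w₂ N)) := by
  have hk0 : 0 < k := by linarith
  have hfst₁ : ∀ n ≤ N, (w₁ n).1 = k ^ n * s := by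
    intro n
    induction n with
    | zero => simp [hw₁0]
    | succ n ih =>
      intro hn
      rw [hstep₁ n (by omega), ih (by omega)]
      ring
  have hvert₂ : ∀ n ≤ N, (w₂ n).1 = 0 ∧ (1 / (a * k)) ^ n * ‖q‖ ≤ ‖(w₂ n).2‖ := by
    intro n
    induction n with
    | zero => simp [hw₂0]
    | succ n ih =>
      intro hn
      obtain ⟨hfst, hnorm⟩ := ih (by omega)
      rw [hstep₂ n (by omega)]
      refine ⟨by simp [hfst], ?_⟩
      calc (1 / (a * k)) ^ (n + 1) * ‖q‖ = 1 / (a * k) * ((1 / (a * k)) ^ n * ‖q‖) := by ring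
        _ ≤ 1 / (a * k) * ‖(w₂ n).2‖ := by gcongr
        _ ≤ ‖A n (w₂ n).2‖ := (hA n (by omega) _).1
        _ = _ := by simp [hfst]
  have hlow : (a ^ N)⁻¹ * (|s| * ‖q‖) ≤ crossNorm (w₁ N) (w₂ N) := by
    obtain ⟨hfst, hnorm⟩ := hvert₂ N le_rfl
    calc (a ^ N)⁻¹ * (|s| * ‖q‖) = k ^ N * |s| * ((1 / (a * k)) ^ N * ‖q‖) := by
          rw [div_pow, mul_pow]
          field_simp
          simp
      _ ≤ k ^ N * |s| * ‖(w₂ N).2‖ := by gcongr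
      _ = |(w₁ N).1| * ‖(w₂ N).2‖ := by
          rw [hfst₁ N le_rfl, abs_mul, abs_of_pos (pow_pos hk0 N)]
      _ ≤ crossNorm ((w₁ N).1, (w₁ N).2) (0, (w₂ N).2) := le_crossNorm_vertical _ _ _
      _ = crossNorm (w₁ N) (w₂ N) := by rw [← hfst]
  have hup : crossNorm (w₁ 0) (w₂ 0) ≤ √(1 + c ^ 2) * (|s| * ‖q‖) := by
    rw [hw₁0, hw₂0]
    exact crossNorm_vertical_le hp q
  have hsqrt : 0 < √(1 + c ^ 2) := by positivity
  have hmain : (a ^ N)⁻¹ / √(1 + c ^ 2) * crossNorm (w₁ 0) (w₂ 0)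
      ≤ crossNorm (w₁ N) (w₂ N) :=
    calc (a ^ N)⁻¹ / √(1 + c ^ 2) * crossNorm (w₁ 0) (w₂ 0)
        ≤ (a ^ N)⁻¹ / √(1 + c ^ 2) * (√(1 + c ^ 2) * (|s| * ‖q‖)) := by gcongr
      _ = (a ^ N)⁻¹ * (|s| * ‖q‖) := by field_simp
      _ ≤ _ := hlow
  refine ⟨hmain, fun hlt hne => lt_of_lt_of_le ?_ hmain⟩
  have hpos : 0 < crossNorm (w₁ 0) (w₂ 0) := by
    rw [crossNorm, norm_pos_iff]
    simpa using hne
  refine lt_mul_of_one_lt_left hpos ?_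
  rw [inv_eq_one_div, div_div]
  exact (one_lt_div (by positivity)).2 hlt
end
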